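/- arXiv:2109.06529 — 2 statements merged into one kernel-verified Lean document; each statement's English description precedes it below -/
import Mathlib

section
/- Let d ≥ 1, P a d×d real orthogonal matrix, ρ_1,…,ρ_d > 0, α < 0 real, ω_i = √(-α ρ_i), and define p(t,y,z) = ∏_{i=1}^d √(ω_i / (2π sinh(ω_i t))) · exp( - ω_i ( ((Py)_i² + (Pz)_i²) cosh(ω_i t) - 2 (Py)_i (Pz)_i ) / (2 sinh(ω_i t)) ) for t > 0 and y, z ∈ ℝ^d. Then for every bounded continuous function f : ℝ^d → ℂ and every y ∈ ℝ^d, ∫_{ℝ^d} p(t,y,z) f(z) dz converges to f(y) as t → 0⁺. -/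
open MeasureTheory ProbabilityTheory Filter Topology

/-- Affine change of variables `z = A u + b` in an integral over Euclidean space. -/
lemma integral_euclideanSpace_eq_abs_det_smul {ι E : Type*} [Fintype ι] [DecidableEq ι]
    [NormedAddCommGroup E] [NormedSpace ℝ E] {A : Matrix ι ι ℝ} (hA : A.det ≠ 0) (b : ι → ℝ)
    (g : EuclideanSpace ℝ ι → E) :
    ∫ z, g z = |A.det| • ∫ u : ι → ℝ, g (WithLp.toLp 2 (A.mulVec u + b)) := by
  have hinj : Function.Injective (Matrix.toLin' A) :=
    Matrix.mulVec_injective_of_isUnit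
      ((Matrix.isUnit_iff_isUnit_det A).2 (isUnit_iff_ne_zero.2 hA))
  have hemb : MeasurableEmbedding (Matrix.toLin' A) :=
    (LinearMap.continuous_of_finiteDimensional _).measurableEmbedding hinj
  have hmap := hemb.integral_map (μ := volume) fun x => g (WithLp.toLp 2 (x + b))
  rw [Real.map_matrix_volume_pi_eq_smul_volume_pi hA, integral_smul_measure,
    integral_add_right_eq_self (fun x : ι → ℝ => g (WithLp.toLp 2 x)) b,
    ENNReal.toReal_ofReal (abs_nonneg _), abs_inv] at hmap
  simp only [Matrix.toLin'_apply] at hmap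
  rw [← hmap, smul_inv_smul₀ (abs_ne_zero.2 hA)]
  exact ((PiLp.volume_preserving_toLp ι).integral_comp
    (MeasurableEquiv.toLp 2 (ι → ℝ)).measurableEmbedding g).symm

namespace Mehler

/-- The standard deviation of the Gaussian `v ↦ K(t, a, v)`, for the one-dimensional Mehler
kernel `K` of frequency `w`. -/
noncomputable def scale (w t : ℝ) : ℝ := √(Real.sinh (w * t) / (w * Real.cosh (w * t)))

/-- The total mass of `v ↦ K(t, a, v)`, for the one-dimensional Mehler kernel `K` of
frequency `w`. -/
noncomputable def mass (w a t : ℝ) : ℝ :=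
  Real.exp (-(w * a ^ 2 * Real.sinh (w * t) / (2 * Real.cosh (w * t)))) /
    √(Real.cosh (w * t))

/-- Completing the square in the one-dimensional Mehler kernel. -/
lemma scale_mul_kernel_eq {w t : ℝ} (hw : 0 < w) (ht : 0 < t) (a u : ℝ) :
    scale w t * (√(w / (2 * Real.pi * Real.sinh (w * t))) *
      Real.exp (-(w * ((a ^ 2 + (scale w t * u + a / Real.cosh (w * t)) ^ 2) * Real.cosh (w * t)
          - 2 * a * (scale w t * u + a / Real.cosh (w * t))) / (2 * Real.sinh (w * t))))) =
      mass w a t * gaussianPDFReal 0 1 u := by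
  have hs : 0 < Real.sinh (w * t) := Real.sinh_pos_iff.2 (by positivity)
  have hc : 0 < Real.cosh (w * t) := Real.cosh_pos _
  have hcs : Real.cosh (w * t) ^ 2 = Real.sinh (w * t) ^ 2 + 1 := Real.cosh_sq _
  have hσ : scale w t ^ 2 = Real.sinh (w * t) / (w * Real.cosh (w * t)) :=
    Real.sq_sqrt (by positivity)
  have hroot : scale w t * √(w / (2 * Real.pi * Real.sinh (w * t))) =
      (√(Real.cosh (w * t)))⁻¹ * (√(2 * Real.pi))⁻¹ := by
    rw [scale, ← Real.sqrt_mul (by positivity), ← Real.sqrt_inv, ← Real.sqrt_inv,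
      ← Real.sqrt_mul (by positivity)]
    congr 1
    field_simp
  have hexp : -(w * ((a ^ 2 + (scale w t * u + a / Real.cosh (w * t)) ^ 2) * Real.cosh (w * t)
        - 2 * a * (scale w t * u + a / Real.cosh (w * t))) / (2 * Real.sinh (w * t))) =
      -(w * a ^ 2 * Real.sinh (w * t) / (2 * Real.cosh (w * t))) + -u ^ 2 / 2 := by
    have hexpand : (a ^ 2 + (scale w t * u + a / Real.cosh (w * t)) ^ 2) * Real.cosh (w * t)
        - 2 * a * (scale w t * u + a / Real.cosh (w * t)) =
        scale w t ^ 2 * u ^ 2 * Real.cosh (w * t)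
          + a ^ 2 * (Real.cosh (w * t) ^ 2 - 1) / Real.cosh (w * t) := by
      field_simp
      ring
    rw [hexpand, hσ, hcs]
    field_simp
    ring
  rw [← mul_assoc, hroot, hexp, Real.exp_add, mass, gaussianPDFReal_def]
  simp only [NNReal.coe_one, mul_one, sub_zero]
  ring

lemma scale_pos {w t : ℝ} (hw : 0 < w) (ht : 0 < t) : 0 < scale w t := by
  have hs : 0 < Real.sinh (w * t) := Real.sinh_pos_iff.2 (by positivity)
  have hc : 0 < Real.cosh (w * t) := Real.cosh_pos _
  exact Real.sqrt_pos.2 (by positivity)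

lemma mass_nonneg (w a t : ℝ) : 0 ≤ mass w a t := by
  unfold mass
  positivity

lemma mass_le_one {w t : ℝ} (hw : 0 < w) (ht : 0 < t) (a : ℝ) : mass w a t ≤ 1 := by
  have hs : 0 < Real.sinh (w * t) := Real.sinh_pos_iff.2 (by positivity)
  have hc : 0 < Real.cosh (w * t) := Real.cosh_pos _
  refine div_le_one_of_le₀ (le_trans (Real.exp_le_one_iff.2 ?_)
    (Real.one_le_sqrt.2 (Real.one_le_cosh _))) (Real.sqrt_nonneg _)
  exact neg_nonpos.2 (by positivity)

lemma tendsto_scale {w : ℝ} (hw : 0 < w) : Tendsto (scale w) (𝓝 0) (𝓝 0) := by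
  have hcont : Continuous (scale w) := by
    unfold scale
    refine Real.continuous_sqrt.comp (Continuous.div (by fun_prop) (by fun_prop) fun t => ?_)
    exact (mul_pos hw (Real.cosh_pos _)).ne'
  exact hcont.tendsto' _ _ (by simp [scale])

lemma tendsto_mass (w a : ℝ) : Tendsto (mass w a) (𝓝 0) (𝓝 1) := by
  have hcont : Continuous (mass w a) := by
    unfold mass
    refine Continuous.div (Real.continuous_exp.comp (Continuous.neg
      (Continuous.div (by fun_prop) (by fun_prop) fun t => ?_))) (by fun_prop) fun t => ?_
    · exact (mul_pos two_pos (Real.cosh_pos _)).ne'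
    · exact (Real.sqrt_pos.2 (Real.cosh_pos _)).ne'
  exact hcont.tendsto' _ _ (by simp [mass])

lemma tendsto_center (w a : ℝ) : Tendsto (fun t => a / Real.cosh (w * t)) (𝓝 0) (𝓝 a) := by
  have hcont : Continuous fun t => a / Real.cosh (w * t) :=
    Continuous.div (by fun_prop) (by fun_prop) fun t => (Real.cosh_pos _).ne'
  exact hcont.tendsto' _ _ (by simp)

end Mehler

/-- Proposition 1.2 for `α < 0`, Dirac initial condition: the Mehler-type
kernel built from `ω_i = √(-αρ_i)` satisfies `∫ p(t,y,z) f(z) dz → f(y)` as `t → 0⁺`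
for every bounded continuous `f : ℝ^d → ℂ`. -/
theorem stmt_3 (d : ℕ) (hd : 1 ≤ d) (P : Matrix (Fin d) (Fin d) ℝ)
    (hP : P.transpose * P = 1) (ρ : Fin d → ℝ) (hρ : ∀ i, 0 < ρ i)
    (α : ℝ) (hα : α < 0) (ω : Fin d → ℝ) (hω : ∀ i, ω i = Real.sqrt (-α * ρ i))
    (p : ℝ → EuclideanSpace ℝ (Fin d) → EuclideanSpace ℝ (Fin d) → ℝ)
    (hp : ∀ (t : ℝ) (y z : EuclideanSpace ℝ (Fin d)), p t y z = ∏ i : Fin d,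
      Real.sqrt (ω i / (2 * Real.pi * Real.sinh (ω i * t))) *
        Real.exp (-(ω i * (((P.mulVec (fun j => y j) i) ^ 2
              + (P.mulVec (fun j => z j) i) ^ 2) * Real.cosh (ω i * t)
            - 2 * P.mulVec (fun j => y j) i * P.mulVec (fun j => z j) i)
          / (2 * Real.sinh (ω i * t)))))
    (f : EuclideanSpace ℝ (Fin d) → ℂ) (hf : Continuous f)
    (hfb : ∃ M : ℝ, ∀ x, ‖f x‖ ≤ M) (y : EuclideanSpace ℝ (Fin d)) :
    Filter.Tendsto (fun t : ℝ => ∫ z : EuclideanSpace ℝ (Fin d), (p t y z : ℂ) * f z)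
      (nhdsWithin 0 (Set.Ioi 0)) (nhds (f y)) := by
  obtain ⟨M, hM⟩ := hfb
  have hω_pos : ∀ i, 0 < ω i := fun i => by
    rw [hω]
    exact Real.sqrt_pos.2 (mul_pos (neg_pos.2 hα) (hρ i))
  have hPPt : P * P.transpose = 1 := mul_eq_one_comm.1 hP
  have hdetP : |P.transpose.det| = 1 := by
    have h := congrArg Matrix.det hP
    rw [Matrix.det_mul, Matrix.det_transpose, Matrix.det_one] at h
    rw [Matrix.det_transpose, ← abs_one, abs_eq_abs]
    exact mul_self_eq_one_iff.1 h
  set a : Fin d → ℝ := P.mulVec (fun j => y j) with ha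
  set x : ℝ → (Fin d → ℝ) → Fin d → ℝ := fun t u i =>
    Mehler.scale (ω i) t * u i + a i / Real.cosh (ω i * t) with hx
  set F : ℝ → (Fin d → ℝ) → ℂ := fun t u =>
    ((∏ i, Mehler.mass (ω i) (a i) t * gaussianPDFReal 0 1 (u i) : ℝ) : ℂ) *
      f (WithLp.toLp 2 (P.transpose.mulVec (x t u))) with hF
  have hint : ∀ t : ℝ, 0 < t → ∫ z, (p t y z : ℂ) * f z = ∫ u, F t u := by
    intro t ht
    have hdet : |(P.transpose * Matrix.diagonal fun i => Mehler.scale (ω i) t).det| =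
        ∏ i, Mehler.scale (ω i) t := by
      rw [Matrix.det_mul, abs_mul, hdetP, one_mul, Matrix.det_diagonal,
        abs_of_pos (Finset.prod_pos fun i _ => Mehler.scale_pos (hω_pos i) ht)]
    have hdet_ne : (P.transpose * Matrix.diagonal fun i => Mehler.scale (ω i) t).det ≠ 0 := by
      rw [← abs_pos, hdet]
      exact Finset.prod_pos fun i _ => Mehler.scale_pos (hω_pos i) ht
    rw [integral_euclideanSpace_eq_abs_det_smul hdet_ne
      (P.transpose.mulVec fun i => a i / Real.cosh (ω i * t)), hdet, ← integral_smul]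
    refine integral_congr_ae (ae_of_all _ fun u => ?_)
    have hpoint : (P.transpose * Matrix.diagonal fun i => Mehler.scale (ω i) t).mulVec u +
        P.transpose.mulVec (fun i => a i / Real.cosh (ω i * t)) =
        P.transpose.mulVec (x t u) := by
      rw [← Matrix.mulVec_mulVec, ← Matrix.mulVec_add]
      congr 1
      ext i
      simp [hx, Matrix.mulVec_diagonal]
    have hPx : P.mulVec (P.transpose.mulVec (x t u)) = x t u := by
      rw [Matrix.mulVec_mulVec, hPPt, Matrix.one_mulVec]
    simp only [hpoint, hF, hp, hPx]
    rw [Complex.real_smul, ← mul_assoc, ← Complex.ofReal_mul, ← Finset.prod_mul_distrib]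
    congr 2
    exact Finset.prod_congr rfl fun i _ => Mehler.scale_mul_kernel_eq (hω_pos i) ht (a i) (u i)
  have hφ : Integrable fun u : Fin d → ℝ => ∏ i, gaussianPDFReal 0 1 (u i) :=
    Integrable.fintype_prod fun _ => integrable_gaussianPDFReal 0 1
  have hlim : Tendsto (fun t => ∫ u, F t u) (𝓝[>] 0)
      (𝓝 (∫ u : Fin d → ℝ, ((∏ i, gaussianPDFReal 0 1 (u i) : ℝ) : ℂ) * f y)) := by
    refine tendsto_integral_filter_of_dominated_convergence
      (fun u => (∏ i, gaussianPDFReal 0 1 (u i)) * M) ?_ ?_ (hφ.mul_const M) ?_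
    · refine Eventually.of_forall fun t => AEStronglyMeasurable.mul ?_ ?_
      · exact (Complex.measurable_ofReal.comp (by fun_prop)).aestronglyMeasurable
      · exact (hf.comp (by fun_prop)).aestronglyMeasurable
    · filter_upwards [self_mem_nhdsWithin] with t ht
      refine ae_of_all _ fun u => ?_
      have hterm : ∀ i, 0 ≤ Mehler.mass (ω i) (a i) t * gaussianPDFReal 0 1 (u i) := fun i =>
        mul_nonneg (Mehler.mass_nonneg _ _ _) (gaussianPDFReal_nonneg _ _ _)
      rw [norm_mul, Complex.norm_real, Real.norm_of_nonneg (Finset.prod_nonneg fun i _ => hterm i)]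
      refine mul_le_mul (Finset.prod_le_prod (fun i _ => hterm i) fun i _ => ?_) (hM _)
        (norm_nonneg _) (Finset.prod_nonneg fun i _ => gaussianPDFReal_nonneg _ _ _)
      exact mul_le_of_le_one_left (gaussianPDFReal_nonneg _ _ _)
        (Mehler.mass_le_one (hω_pos i) ht _)
    · refine ae_of_all _ fun u => Tendsto.mono_left (Tendsto.mul ?_ ?_) nhdsWithin_le_nhds
      · refine (Complex.continuous_ofReal.tendsto _).comp (tendsto_finsetProd _ fun i _ => ?_)
        simpa using (Mehler.tendsto_mass (ω i) (a i)).mul_const (gaussianPDFReal 0 1 (u i))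
      · have hxlim : Tendsto (fun t => x t u) (𝓝 0) (𝓝 a) := by
          refine tendsto_pi_nhds.2 fun i => ?_
          simpa using ((Mehler.tendsto_scale (hω_pos i)).mul_const (u i)).add
            (Mehler.tendsto_center (ω i) (a i))
        have hcont : Continuous fun v : Fin d → ℝ =>
            f (WithLp.toLp 2 (P.transpose.mulVec v)) := hf.comp (by fun_prop)
        have hval : WithLp.toLp 2 (P.transpose.mulVec a) = y := by
          rw [ha, Matrix.mulVec_mulVec, hP, Matrix.one_mulVec]
        simpa only [hval, Function.comp_def] using (hcont.tendsto a).comp hxlim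
  have hmass : ∫ u : Fin d → ℝ, ((∏ i, gaussianPDFReal 0 1 (u i) : ℝ) : ℂ) * f y = f y := by
    rw [integral_mul_const, integral_complex_ofReal, integral_fintype_prod_volume_eq_prod]
    simp [integral_gaussianPDFReal_eq_one]
  rw [hmass] at hlim
  exact hlim.congr' (eventually_nhdsWithin_of_forall fun t ht => (hint t ht).symm)
end

section
/- Let d ≥ 1, a ∈ ℝ^d with a ≠ 0, σ²(t) = t³/12, and p(t,x,y,x',y') = (1/(√(2π) ‖a‖ σ(t))) · exp( -(x' - x - t⟨a, y + y'⟩/2)² / (2‖a‖² σ²(t)) ) · (2π t)^{-d/2} exp(-‖y' - y‖²/(2t)) for t > 0. Then for every bounded continuous f : ℝ × ℝ^d → ℂ and every (x,y) ∈ ℝ × ℝ^d, ∫_{ℝ × ℝ^d} p(t,x,y,x',y') f(x',y') dx' dy' converges to f(x,y) as t → 0⁺. -/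
open scoped RealInnerProductSpace
open MeasureTheory Filter Topology

/-- The image of Lebesgue measure under a homothety followed by a translation. -/
theorem map_volume_add_smul {E : Type*} [NormedAddCommGroup E] [InnerProductSpace ℝ E]
    [FiniteDimensional ℝ E] [MeasurableSpace E] [BorelSpace E] (w : E) {s : ℝ} (hs : s ≠ 0) :
    (volume : Measure E).map (fun v => w + s • v) =
      ENNReal.ofReal |(s ^ Module.finrank ℝ E)⁻¹| • volume := by
  have h : (fun v : E => w + s • v) = (fun v => w + v) ∘ (fun v => s • v) := rfl
  rw [h, ← Measure.map_map (measurable_const_add w) (measurable_const_smul s),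
    Measure.map_addHaar_smul volume hs, Measure.map_smul, map_add_left_eq_self]

/-- Change of variables for a fibred affine map of `ℝ × E`. -/
theorem integral_prod_eq_integral_skew_affine {E : Type*} [NormedAddCommGroup E]
    [InnerProductSpace ℝ E] [FiniteDimensional ℝ E] [MeasurableSpace E] [BorelSpace E]
    {F : ℝ × E → ℂ} (hF : Continuous F) {c : E → ℝ} (hc : Continuous c) (y : E)
    {r s : ℝ} (hr : 0 < r) (hs : 0 < s) :
    ∫ q, F q = ((r * s ^ Module.finrank ℝ E : ℝ) : ℂ) *
      ∫ z : E × ℝ, F (c z.1 + r * z.2, y + s • z.1) := by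
  have hbase : MeasurePreserving (fun v : E => y + s • v) volume
      (ENNReal.ofReal |(s ^ Module.finrank ℝ E)⁻¹| • volume) :=
    ⟨by fun_prop, map_volume_add_smul y hs.ne'⟩
  have hskew : MeasurePreserving (fun z : E × ℝ => (y + s • z.1, c z.1 + r * z.2))
      (volume.prod volume)
      ((ENNReal.ofReal |(s ^ Module.finrank ℝ E)⁻¹| • volume).prod
        (ENNReal.ofReal |(r ^ Module.finrank ℝ ℝ)⁻¹| • volume)) :=
    hbase.skew_product (g := fun v u => c v + r * u)
      (Continuous.measurable (by fun_prop))
      (Eventually.of_forall fun v => map_volume_add_smul (c v) hr.ne')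
  have hint : ∫ z : E × ℝ, F (c z.1 + r * z.2, y + s • z.1) =
      ∫ w, F w.swap ∂((ENNReal.ofReal |(s ^ Module.finrank ℝ E)⁻¹| • volume).prod
        (ENNReal.ofReal |(r ^ Module.finrank ℝ ℝ)⁻¹| • volume)) := by
    rw [← hskew.map_eq]
    exact (integral_map hskew.measurable.aemeasurable
      (hF.comp continuous_swap).aestronglyMeasurable).symm
  rw [hint, Measure.prod_smul_left, Measure.prod_smul_right, integral_smul_measure,
    integral_smul_measure, integral_prod_swap, ← Measure.volume_eq_prod]
  have hs' : 0 < s ^ Module.finrank ℝ E := pow_pos hs _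
  rw [ENNReal.toReal_ofReal (abs_nonneg _), ENNReal.toReal_ofReal (abs_nonneg _),
    abs_of_pos (inv_pos.2 hs'), Module.finrank_self, pow_one, abs_of_pos (inv_pos.2 hr),
    Complex.real_smul, Complex.real_smul, ← mul_assoc, ← mul_assoc, ← Complex.ofReal_mul,
    ← Complex.ofReal_mul]
  have h1 : r * s ^ Module.finrank ℝ E * (s ^ Module.finrank ℝ E)⁻¹ * r⁻¹ = 1 := by
    field_simp
  rw [h1, Complex.ofReal_one, one_mul]

/-- The standard Gaussian density on a product `E × ℝ`. -/
noncomputable def gaussianProdDensity {E : Type*} [NormedAddCommGroup E]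
    [InnerProductSpace ℝ E] (z : E × ℝ) : ℝ :=
  ((2 * Real.pi) ^ (-(Module.finrank ℝ E : ℝ) / 2) * Real.exp (-(1 / 2) * ‖z.1‖ ^ 2)) *
    ((Real.sqrt (2 * Real.pi))⁻¹ * Real.exp (-(1 / 2) * z.2 ^ 2))

theorem gaussianProdDensity_nonneg {E : Type*} [NormedAddCommGroup E] [InnerProductSpace ℝ E]
    (z : E × ℝ) : 0 ≤ gaussianProdDensity z := by
  unfold gaussianProdDensity; positivity

theorem continuous_gaussianProdDensity {E : Type*} [NormedAddCommGroup E]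
    [InnerProductSpace ℝ E] : Continuous (gaussianProdDensity (E := E)) := by
  unfold gaussianProdDensity; fun_prop

theorem integral_gaussianProdDensity {E : Type*} [NormedAddCommGroup E]
    [InnerProductSpace ℝ E] [FiniteDimensional ℝ E] [MeasurableSpace E] [BorelSpace E] :
    ∫ z : E × ℝ, gaussianProdDensity z = 1 := by
  unfold gaussianProdDensity
  rw [Measure.volume_eq_prod, integral_prod_mul
    (fun v : E => (2 * Real.pi) ^ (-(Module.finrank ℝ E : ℝ) / 2) *
      Real.exp (-(1 / 2) * ‖v‖ ^ 2))
    (fun u : ℝ => (Real.sqrt (2 * Real.pi))⁻¹ * Real.exp (-(1 / 2) * u ^ 2)),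
    integral_const_mul, integral_const_mul, integral_gaussian,
    GaussianFourier.integral_rexp_neg_mul_sq_norm (by norm_num : (0 : ℝ) < 1 / 2)]
  have h2 : Real.pi / (1 / 2) = 2 * Real.pi := by ring
  rw [h2, neg_div, ← Real.rpow_add (by positivity), neg_add_cancel, Real.rpow_zero, one_mul,
    inv_mul_cancel₀ (by positivity)]

/-- Under the parabolic scaling the kernel becomes the standard Gaussian density. -/
theorem kernel_scaling {E : Type*} [NormedAddCommGroup E] [InnerProductSpace ℝ E]
    {a : E} (ha : a ≠ 0) {t S : ℝ} (ht : 0 < t) (hS : 0 < S) (x m : ℝ) (y v : E) (u : ℝ) :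
    (‖a‖ * √S * √t ^ Module.finrank ℝ E) *
      ((1 / (√(2 * Real.pi) * ‖a‖ * √S)) *
        Real.exp (-(x + m + ‖a‖ * √S * u - x - m) ^ 2 / (2 * ‖a‖ ^ 2 * S)) *
        ((2 * Real.pi * t) ^ (-(Module.finrank ℝ E : ℝ) / 2) *
          Real.exp (-‖y + √t • v - y‖ ^ 2 / (2 * t)))) = gaussianProdDensity (v, u) := by
  have ha' : 0 < ‖a‖ := norm_pos_iff.2 ha
  have hS' : 0 < √S := Real.sqrt_pos.2 hS
  have h1 : -(x + m + ‖a‖ * √S * u - x - m) ^ 2 / (2 * ‖a‖ ^ 2 * S) = -(1 / 2) * u ^ 2 := by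
    have h : (x + m + ‖a‖ * √S * u - x - m) ^ 2 = ‖a‖ ^ 2 * S * u ^ 2 := by
      rw [show x + m + ‖a‖ * √S * u - x - m = ‖a‖ * √S * u by ring, mul_pow, mul_pow,
        Real.sq_sqrt hS.le]
    rw [h]; field_simp
  have h2 : -‖y + √t • v - y‖ ^ 2 / (2 * t) = -(1 / 2) * ‖v‖ ^ 2 := by
    rw [add_sub_cancel_left, norm_smul, mul_pow, Real.norm_eq_abs, sq_abs, Real.sq_sqrt ht.le]
    field_simp
  have h3 : √t ^ Module.finrank ℝ E * t ^ (-(Module.finrank ℝ E : ℝ) / 2) = 1 := by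
    rw [Real.sqrt_eq_rpow, ← Real.rpow_natCast, ← Real.rpow_mul ht.le, ← Real.rpow_add ht]
    ring_nf
    exact Real.rpow_zero t
  rw [h1, h2, Real.mul_rpow (by positivity) ht.le, gaussianProdDensity]
  calc _ = (√t ^ Module.finrank ℝ E * t ^ (-(Module.finrank ℝ E : ℝ) / 2)) *
        ((‖a‖ * √S) * (1 / (√(2 * Real.pi) * ‖a‖ * √S))) *
        (Real.exp (-(1 / 2) * u ^ 2) * ((2 * Real.pi) ^ (-(Module.finrank ℝ E : ℝ) / 2) *
          Real.exp (-(1 / 2) * ‖v‖ ^ 2))) := by ring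
    _ = _ := by
      have h4 : (‖a‖ * √S) * (1 / (√(2 * Real.pi) * ‖a‖ * √S)) = (√(2 * Real.pi))⁻¹ := by
        field_simp
      rw [h3, h4]; ring

/-- A Gaussian average of a bounded continuous function along maps converging pointwise to a
point converges to the value at that point. -/
theorem tendsto_integral_gaussianProdDensity_mul {E X : Type*} [NormedAddCommGroup E]
    [InnerProductSpace ℝ E] [FiniteDimensional ℝ E] [MeasurableSpace E] [BorelSpace E]
    [TopologicalSpace X] {f : X → ℂ} (hf : Continuous f) {M : ℝ} (hM : ∀ q, ‖f q‖ ≤ M)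
    {l : Filter ℝ} [l.IsCountablyGenerated] {Φ : ℝ → E × ℝ → X} (hΦ : ∀ t, Continuous (Φ t))
    {q : X} (hq : ∀ z, Tendsto (fun t => Φ t z) l (𝓝 q)) :
    Tendsto (fun t => ∫ z, (gaussianProdDensity z : ℂ) * f (Φ t z)) l (𝓝 (f q)) := by
  have hlim : ∫ z : E × ℝ, (gaussianProdDensity z : ℂ) * f q = f q := by
    rw [integral_mul_const, integral_complex_ofReal, integral_gaussianProdDensity,
      Complex.ofReal_one, one_mul]
  have hi : Integrable (gaussianProdDensity (E := E)) :=
    Integrable.of_integral_ne_zero (by rw [integral_gaussianProdDensity]; exact one_ne_zero)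
  have hcont := continuous_gaussianProdDensity (E := E)
  conv => rhs; rw [← hlim]
  refine tendsto_integral_filter_of_dominated_convergence
    (fun z => gaussianProdDensity z * M) ?_ ?_ (hi.mul_const M) ?_
  · exact Eventually.of_forall fun t => Continuous.aestronglyMeasurable
      ((Complex.continuous_ofReal.comp hcont).mul (hf.comp (hΦ t)))
  · refine Eventually.of_forall fun t => Eventually.of_forall fun z => ?_
    rw [norm_mul, Complex.norm_real, Real.norm_of_nonneg (gaussianProdDensity_nonneg z)]
    exact mul_le_mul_of_nonneg_left (hM _) (gaussianProdDensity_nonneg z)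
  · exact Eventually.of_forall fun z =>
      ((hf.tendsto q).comp (hq z)).const_mul _

/-- Corollary 1.3, Dirac initial condition: the explicit kernel of the
linear Kolmogorov hypoelliptic equation satisfies
`∫∫ p(t,x,y,x',y') f(x',y') dx'dy' → f(x,y)` as `t → 0⁺` for bounded continuous `f`. -/
theorem stmt_7 (d : ℕ) (hd : 1 ≤ d) (a : EuclideanSpace ℝ (Fin d)) (ha : a ≠ 0)
    (σsq : ℝ → ℝ) (hσ : ∀ t, σsq t = t ^ 3 / 12)
    (p : ℝ → ℝ → EuclideanSpace ℝ (Fin d) → ℝ → EuclideanSpace ℝ (Fin d) → ℝ)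
    (hp : ∀ (t x : ℝ) (y : EuclideanSpace ℝ (Fin d)) (x' : ℝ)
        (y' : EuclideanSpace ℝ (Fin d)), p t x y x' y' =
      (1 / (Real.sqrt (2 * Real.pi) * ‖a‖ * Real.sqrt (σsq t))) *
        Real.exp (-(x' - x - t * ⟪a, y + y'⟫ / 2) ^ 2 / (2 * ‖a‖ ^ 2 * σsq t)) *
        ((2 * Real.pi * t) ^ (-(d : ℝ) / 2) * Real.exp (-‖y' - y‖ ^ 2 / (2 * t))))
    (f : ℝ × EuclideanSpace ℝ (Fin d) → ℂ) (hf : Continuous f)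
    (hfb : ∃ M : ℝ, ∀ q, ‖f q‖ ≤ M) (x : ℝ) (y : EuclideanSpace ℝ (Fin d)) :
    Filter.Tendsto
      (fun t : ℝ => ∫ q : ℝ × EuclideanSpace ℝ (Fin d), (p t x y q.1 q.2 : ℂ) * f q)
      (nhdsWithin 0 (Set.Ioi 0)) (nhds (f (x, y))) := by
  obtain ⟨M, hM⟩ := hfb
  let Φ : ℝ → EuclideanSpace ℝ (Fin d) × ℝ → ℝ × EuclideanSpace ℝ (Fin d) := fun t z =>
    (x + t * ⟪a, y + (y + √t • z.1)⟫ / 2 + ‖a‖ * √(σsq t) * z.2, y + √t • z.1)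
  have hσc : Continuous σsq := by
    rw [funext hσ]; fun_prop
  have hΦ : ∀ t, Continuous (Φ t) := fun t => by fun_prop
  have hq : ∀ z, Tendsto (fun t => Φ t z) (𝓝[>] 0) (𝓝 (x, y)) := fun z => by
    have hc : Continuous fun t => Φ t z := by fun_prop
    have h0 : Φ 0 z = (x, y) := by simp [Φ, hσ]
    exact h0 ▸ (hc.tendsto 0).mono_left nhdsWithin_le_nhds
  refine (tendsto_integral_gaussianProdDensity_mul hf hM hΦ hq).congr' ?_
  filter_upwards [self_mem_nhdsWithin] with t ht
  have ht : 0 < t := ht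
  have hS : 0 < σsq t := by rw [hσ]; positivity
  have hpc : Continuous fun q : ℝ × EuclideanSpace ℝ (Fin d) => (p t x y q.1 q.2 : ℂ) * f q := by
    simp only [hp]
    fun_prop
  rw [integral_prod_eq_integral_skew_affine hpc
    (c := fun v => x + t * ⟪a, y + (y + √t • v)⟫ / 2) (by fun_prop) y
    (mul_pos (norm_pos_iff.2 ha) (Real.sqrt_pos.2 hS)) (Real.sqrt_pos.2 ht),
    ← integral_const_mul]
  refine integral_congr_ae (Eventually.of_forall fun z => ?_)
  have h := kernel_scaling ha ht hS x (t * ⟪a, y + (y + √t • z.1)⟫ / 2) y z.1 z.2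
  simp only [finrank_euclideanSpace_fin] at h
  simp only [finrank_euclideanSpace_fin, hp, ← h, Φ]
  push_cast
  ring
end
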